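/- Let {Z_t}_{t≥0} be a centered stationary Gaussian process with continuous sample paths, E[Z_t²] = 1, and nonnegative covariance A(s,t) = E[Z_s Z_t] ≥ 0 depending only on t − s. Then the limit lim_{T→∞} (1/T) log P(sup_{t∈[0,T]} Z_t < 0) exists in [−∞, 0]. -/

import Mathlib

open MeasureTheory ProbabilityTheory Filter Set

noncomputable section

/-- A real random variable is centered Gaussian if its law is `gaussianReal 0 v`
for some variance `v ≥ 0`. -/
def IsCenteredGaussian {Ω : Type*} [MeasurableSpace Ω] (μ : Measure Ω) (X : Ω → ℝ) : Prop :=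
  ∃ v : NNReal, Measure.map X μ = gaussianReal 0 v

/-- A centered Gaussian process: every finite linear combination of its values is a
centered Gaussian real random variable. -/
def IsCenteredGaussianProcess {Ω : Type*} [MeasurableSpace Ω] (μ : Measure Ω)
    {T : Type*} (Z : T → Ω → ℝ) : Prop :=
  ∀ (n : ℕ) (c : Fin n → ℝ) (t : Fin n → T),
    IsCenteredGaussian μ (fun ω => ∑ i, c i * Z (t i) ω)

structure Good {ι : Type*} [Fintype ι] (C : ℝ) (u : (ι → ℝ) → ℝ) (L : ι → (ι → ℝ) → ℝ) :
    Prop where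
  bd : ∀ x, |u x| ≤ 1
  cu : Continuous u
  cL : ∀ i, Continuous (L i)
  Lneg : ∀ i x, L i x ≤ 0
  Lbd : ∀ i x, |L i x| ≤ C
  tay : ∀ x h, |u (x + h) - u x - ∑ i, L i x * h i| ≤ C * ‖h‖ ^ 2

def smoothOp {ι : Type*} [Fintype ι] (γ : Measure (ι → ℝ)) (ε : ℝ) (u : (ι → ℝ) → ℝ)
    (x : ι → ℝ) : ℝ := ∫ y, u (x + ε • y) ∂γ

section
variable {ι : Type*} [Fintype ι] (γ : Measure (ι → ℝ))

lemma intble_bdd [IsProbabilityMeasure γ] {u : (ι → ℝ) → ℝ} {B : ℝ} (hu : Continuous u)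
    (hb : ∀ x, |u x| ≤ B) (ε : ℝ) (x : ι → ℝ) : Integrable (fun y => u (x + ε • y)) γ := by
  refine Integrable.of_bound (C := B) ?_ ?_
  · exact (Continuous.aestronglyMeasurable (by fun_prop))
  · exact ae_of_all _ fun y => by simpa using hb _

lemma smoothOp_cont [IsProbabilityMeasure γ] {u : (ι → ℝ) → ℝ} {B : ℝ} (hu : Continuous u)
    (hb : ∀ x, |u x| ≤ B) (ε : ℝ) : Continuous (smoothOp γ ε u) := by
  unfold smoothOp
  refine continuous_of_dominated (bound := fun _ => B) ?_ ?_ ?_ ?_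
  · intro x; exact (Continuous.aestronglyMeasurable (by fun_prop))
  · intro x; exact ae_of_all _ fun y => by simpa using hb _
  · exact integrable_const _
  · exact ae_of_all _ fun y => by fun_prop

lemma smoothOp_bdd [IsProbabilityMeasure γ] {u : (ι → ℝ) → ℝ} {B : ℝ}
    (hb : ∀ x, |u x| ≤ B) (ε : ℝ) (x : ι → ℝ) : |smoothOp γ ε u x| ≤ B := by
  unfold smoothOp
  have := norm_integral_le_of_norm_le_const (μ := γ) (f := fun y => u (x + ε • y)) (C := B)
    (ae_of_all _ fun y => by simpa using hb _)
  simpa using this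

lemma good_smoothOp [IsProbabilityMeasure γ] {u : (ι → ℝ) → ℝ} {L : ι → (ι → ℝ) → ℝ} {C : ℝ}
    (h : Good C u L) (ε : ℝ) : Good C (smoothOp γ ε u) (fun i => smoothOp γ ε (L i)) where
  bd := smoothOp_bdd γ h.bd ε
  cu := smoothOp_cont γ h.cu h.bd ε
  cL := fun i => smoothOp_cont γ (h.cL i) (h.Lbd i) ε
  Lneg := fun i x => integral_nonpos fun y => h.Lneg i _
  Lbd := fun i x => smoothOp_bdd γ (h.Lbd i) ε x
  tay := by
    intro x k
    have e : smoothOp γ ε u (x + k) - smoothOp γ ε u x - ∑ i, smoothOp γ ε (L i) x * k i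
        = ∫ y, (u ((x + ε • y) + k) - u (x + ε • y) - ∑ i, L i (x + ε • y) * k i) ∂γ := by
      have i1 := intble_bdd γ h.cu h.bd ε (x + k)
      have i1' : Integrable (fun y => u ((x + ε • y) + k)) γ := by
        simpa only [add_right_comm] using i1
      have i2 := intble_bdd γ h.cu h.bd ε x
      have i3 : ∀ i ∈ Finset.univ, Integrable (fun y => L i (x + ε • y) * k i) γ := fun i _ =>
        (intble_bdd γ (h.cL i) (h.Lbd i) ε x).mul_const _
      have i12 : Integrable (fun y => u ((x + ε • y) + k) - u (x + ε • y)) γ := i1'.sub i2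
      rw [integral_sub i12 (integrable_finsetSum _ i3), integral_sub i1' i2,
        integral_finsetSum _ i3]
      simp only [smoothOp, integral_mul_const, add_right_comm]
    rw [e]
    have := norm_integral_le_of_norm_le_const (μ := γ)
      (f := fun y => u ((x + ε • y) + k) - u (x + ε • y) - ∑ i, L i (x + ε • y) * k i)
      (C := C * ‖k‖ ^ 2)
      (ae_of_all _ fun y => by simpa using h.tay _ _)
    simpa using this

lemma intble_norm_pow [IsGaussian γ] (k : ℕ) : Integrable (fun y : ι → ℝ => ‖y‖ ^ k) γ := by
  have := (IsGaussian.memLp_id γ (k : ENNReal) (by simp)).integrable_norm_pow'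
  simpa using this

lemma intble_coord [IsGaussian γ] (i : ι) : Integrable (fun y : ι → ℝ => y i) γ := by
  exact IsGaussian.integrable_dual γ (ContinuousLinearMap.proj i)

lemma intble_coord2 [IsGaussian γ] (i j : ι) : Integrable (fun y : ι → ℝ => y i * y j) γ := by
  refine (intble_norm_pow γ 2).mono' (by fun_prop) (ae_of_all _ fun y => ?_)
  rw [norm_mul, pow_two]
  exact mul_le_mul (norm_le_pi_norm y i) (norm_le_pi_norm y j) (norm_nonneg _) (norm_nonneg _)

lemma lin_bound {C : ℝ} (l : ι → ℝ) (hl : ∀ i, |l i| ≤ C) (y : ι → ℝ) :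
    |∑ i, l i * y i| ≤ Fintype.card ι * C * ‖y‖ := by
  calc |∑ i, l i * y i| ≤ ∑ i, |l i * y i| := Finset.abs_sum_le_sum_abs _ _
    _ ≤ ∑ _i : ι, C * ‖y‖ := by
      refine Finset.sum_le_sum fun i _ => ?_
      rw [abs_mul]
      exact mul_le_mul (hl i) (norm_le_pi_norm y i) (abs_nonneg _) ((abs_nonneg _).trans (hl i))
    _ = _ := by simp; ring

lemma step_lower [IsGaussian γ] (hmean : ∀ i, ∫ y, y i ∂γ = 0)
    (hcov : ∀ i j, 0 ≤ ∫ y, y i * y j ∂γ) {C : ℝ} (hC : 0 ≤ C) :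
    ∃ K : ℝ, ∀ ε : ℝ, 0 ≤ ε → ε ≤ 1 → ∀ u v L L', Good C u L → Good C v L' → ∀ x,
      smoothOp γ ε u x * smoothOp γ ε v x - K * ε ^ 3 ≤ smoothOp γ ε (fun z => u z * v z) x := by
  set n : ℝ := (Fintype.card ι : ℝ) with hn
  set m2 := ∫ y, ‖y‖ ^ 2 ∂γ with hm2
  set m3 := ∫ y, ‖y‖ ^ 3 ∂γ with hm3
  set m4 := ∫ y, ‖y‖ ^ 4 ∂γ with hm4
  have m2n : 0 ≤ m2 := integral_nonneg fun y => by positivity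
  have m4n : 0 ≤ m4 := integral_nonneg fun y => by positivity
  refine ⟨2 * n * C ^ 2 * m3 + C ^ 2 * m4 + C ^ 2 * m2 ^ 2, ?_⟩
  intro ε hε hε1 u v L L' hu hv x
  set a : (ι → ℝ) → ℝ := fun y => ε * ∑ i, L i x * y i with ha
  set b : (ι → ℝ) → ℝ := fun y => ε * ∑ i, L' i x * y i with hb
  set R : (ι → ℝ) → ℝ := fun y => u (x + ε • y) - u x - a y with hR
  set S : (ι → ℝ) → ℝ := fun y => v (x + ε • y) - v x - b y with hS
  have iu := intble_bdd γ hu.cu hu.bd ε x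
  have iv := intble_bdd γ hv.cu hv.bd ε x
  have iuv : Integrable (fun y => u (x + ε • y) * v (x + ε • y)) γ := by
    refine intble_bdd γ (u := fun z => u z * v z) (B := 1) (hu.cu.mul hv.cu) ?_ ε x
    intro z
    rw [abs_mul]
    exact mul_le_one₀ (hu.bd z) (abs_nonneg _) (hv.bd z)
  have ia : Integrable a γ :=
    (integrable_finsetSum _ fun i _ => (intble_coord γ i).const_mul (L i x)).const_mul ε
  have ib : Integrable b γ :=
    (integrable_finsetSum _ fun i _ => (intble_coord γ i).const_mul (L' i x)).const_mul ε
  have Ea : ∫ y, a y ∂γ = 0 := by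
    simp only [ha]
    rw [integral_const_mul, integral_finsetSum _ fun i _ => (intble_coord γ i).const_mul (L i x)]
    simp [integral_const_mul, hmean]
  have Eb : ∫ y, b y ∂γ = 0 := by
    simp only [hb]
    rw [integral_const_mul, integral_finsetSum _ fun i _ => (intble_coord γ i).const_mul (L' i x)]
    simp [integral_const_mul, hmean]
  have iu0 : Integrable (fun y => u (x + ε • y) - u x) γ := iu.sub (integrable_const _)
  have iv0 : Integrable (fun y => v (x + ε • y) - v x) γ := iv.sub (integrable_const _)
  have iR : Integrable R γ := iu0.sub ia
  have iS : Integrable S γ := iv0.sub ib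
  have abe : ∀ y, a y * b y = ∑ i, ∑ j, (ε ^ 2 * (L i x * L' j x)) * (y i * y j) := by
    intro y
    simp only [ha, hb]
    calc _ = ε ^ 2 * ((∑ i, L i x * y i) * ∑ i, L' i x * y i) := by ring
      _ = _ := by
        rw [Finset.sum_mul_sum, Finset.mul_sum]
        refine Finset.sum_congr rfl fun i _ => ?_
        rw [Finset.mul_sum]
        refine Finset.sum_congr rfl fun j _ => ?_
        ring
  have iab' : ∀ i ∈ Finset.univ, Integrable (fun y : ι → ℝ =>
      ∑ j, (ε ^ 2 * (L i x * L' j x)) * (y i * y j)) γ := fun i _ =>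
    integrable_finsetSum _ fun j _ => (intble_coord2 γ i j).const_mul _
  have iab : Integrable (fun y => a y * b y) γ := by
    simp only [abe]
    exact integrable_finsetSum _ iab'
  have Eab : 0 ≤ ∫ y, a y * b y ∂γ := by
    simp only [abe]
    rw [integral_finsetSum _ iab']
    refine Finset.sum_nonneg fun i _ => ?_
    rw [integral_finsetSum _ fun j _ => (intble_coord2 γ i j).const_mul _]
    refine Finset.sum_nonneg fun j _ => ?_
    rw [integral_const_mul]
    exact mul_nonneg (mul_nonneg (sq_nonneg _)
      (mul_nonneg_of_nonpos_of_nonpos (hu.Lneg _ _) (hv.Lneg _ _))) (hcov i j)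
  have absa : ∀ y, |a y| ≤ ε * (n * C * ‖y‖) := fun y => by
    simp only [ha]
    rw [abs_mul, abs_of_nonneg hε]
    exact mul_le_mul_of_nonneg_left (lin_bound _ (fun i => hu.Lbd i x) y) hε
  have absb : ∀ y, |b y| ≤ ε * (n * C * ‖y‖) := fun y => by
    simp only [hb]
    rw [abs_mul, abs_of_nonneg hε]
    exact mul_le_mul_of_nonneg_left (lin_bound _ (fun i => hv.Lbd i x) y) hε
  have absR : ∀ y, |R y| ≤ C * ε ^ 2 * ‖y‖ ^ 2 := fun y => by
    have := hu.tay x (ε • y)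
    rw [norm_smul, Real.norm_of_nonneg hε, mul_pow, ← mul_assoc] at this
    refine le_trans (le_of_eq ?_) this
    simp only [hR, ha, Pi.smul_apply, smul_eq_mul, Finset.mul_sum]
    congr 3; funext i; ring
  have absS : ∀ y, |S y| ≤ C * ε ^ 2 * ‖y‖ ^ 2 := fun y => by
    have := hv.tay x (ε • y)
    rw [norm_smul, Real.norm_of_nonneg hε, mul_pow, ← mul_assoc] at this
    refine le_trans (le_of_eq ?_) this
    simp only [hS, hb, Pi.smul_apply, smul_eq_mul, Finset.mul_sum]
    congr 3; funext i; ring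
  have ER : ∫ y, (u (x + ε • y) - u x) ∂γ = ∫ y, R y ∂γ := by
    have : ∫ y, R y ∂γ = ∫ y, (u (x + ε • y) - u x) ∂γ - ∫ y, a y ∂γ := integral_sub iu0 ia
    rw [this, Ea, sub_zero]
  have ES : ∫ y, (v (x + ε • y) - v x) ∂γ = ∫ y, S y ∂γ := by
    have : ∫ y, S y ∂γ = ∫ y, (v (x + ε • y) - v x) ∂γ - ∫ y, b y ∂γ := integral_sub iv0 ib
    rw [this, Eb, sub_zero]
  have bER : |∫ y, R y ∂γ| ≤ C * ε ^ 2 * m2 := by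
    rw [hm2, ← integral_const_mul]
    exact norm_integral_le_of_norm_le (f := R) ((intble_norm_pow γ 2).const_mul _) (ae_of_all _ absR)
  have bES : |∫ y, S y ∂γ| ≤ C * ε ^ 2 * m2 := by
    rw [hm2, ← integral_const_mul]
    exact norm_integral_le_of_norm_le (f := S) ((intble_norm_pow γ 2).const_mul _) (ae_of_all _ absS)
  have iUV : Integrable (fun y => (u (x + ε • y) - u x) * (v (x + ε • y) - v x)) γ := by
    have : Integrable (fun y => u (x + ε • y) * v (x + ε • y) - u x * v (x + ε • y)
      - v x * u (x + ε • y) + u x * v x) γ :=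
      ((iuv.sub (iv.const_mul _)).sub (iu.const_mul _)).add (integrable_const _)
    refine this.congr (ae_of_all _ fun y => ?_)
    simp only; ring
  have covid : smoothOp γ ε (fun z => u z * v z) x - smoothOp γ ε u x * smoothOp γ ε v x
      = ∫ y, (u (x + ε • y) - u x) * (v (x + ε • y) - v x) ∂γ
        - (∫ y, (u (x + ε • y) - u x) ∂γ) * ∫ y, (v (x + ε • y) - v x) ∂γ := by
    have e1 : ∫ y, (u (x + ε • y) - u x) * (v (x + ε • y) - v x) ∂γ
      = ∫ y, (u (x + ε • y) * v (x + ε • y) - u x * v (x + ε • y)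
      - v x * u (x + ε • y) + u x * v x) ∂γ := by
      congr 1; funext y; ring
    have j1 : Integrable (fun y => u (x + ε • y) * v (x + ε • y) - u x * v (x + ε • y)) γ :=
      iuv.sub (iv.const_mul _)
    have j2 : Integrable (fun y => u (x + ε • y) * v (x + ε • y) - u x * v (x + ε • y)
      - v x * u (x + ε • y)) γ := j1.sub (iu.const_mul _)
    rw [e1, integral_add j2 (integrable_const _),
      integral_sub j1 (iu.const_mul _), integral_sub iuv (iv.const_mul _),
      integral_sub iu (integrable_const _), integral_sub iv (integrable_const _),
      integral_const_mul, integral_const_mul]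
    simp only [smoothOp, integral_const, probReal_univ, one_smul]
    ring
  have lower : ∫ y, (a y * b y - (2 * n * C ^ 2 * ε ^ 3) * ‖y‖ ^ 3 - (C ^ 2 * ε ^ 4) * ‖y‖ ^ 4) ∂γ
      ≤ ∫ y, (u (x + ε • y) - u x) * (v (x + ε • y) - v x) ∂γ := by
    refine integral_mono ((iab.sub ((intble_norm_pow γ 3).const_mul _)).sub
      ((intble_norm_pow γ 4).const_mul _)) iUV fun y => ?_
    have hUV : (u (x + ε • y) - u x) * (v (x + ε • y) - v x)
      = a y * b y + a y * S y + b y * R y + R y * S y := by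
      simp only [hR, hS]; ring
    have nn := norm_nonneg y
    have h1 : |a y * S y| ≤ (ε * (n * C * ‖y‖)) * (C * ε ^ 2 * ‖y‖ ^ 2) := by
      rw [abs_mul]
      exact mul_le_mul (absa y) (absS y) (abs_nonneg _) ((abs_nonneg _).trans (absa y))
    have h2 : |b y * R y| ≤ (ε * (n * C * ‖y‖)) * (C * ε ^ 2 * ‖y‖ ^ 2) := by
      rw [abs_mul]
      exact mul_le_mul (absb y) (absR y) (abs_nonneg _) ((abs_nonneg _).trans (absb y))
    have h3 : |R y * S y| ≤ (C * ε ^ 2 * ‖y‖ ^ 2) * (C * ε ^ 2 * ‖y‖ ^ 2) := by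
      rw [abs_mul]
      exact mul_le_mul (absR y) (absS y) (abs_nonneg _) ((abs_nonneg _).trans (absR y))
    simp only
    rw [hUV]
    have := (abs_le.1 h1).1
    have := (abs_le.1 h2).1
    have := (abs_le.1 h3).1
    have e3 : 2 * n * C ^ 2 * ε ^ 3 * ‖y‖ ^ 3
      = 2 * ((ε * (n * C * ‖y‖)) * (C * ε ^ 2 * ‖y‖ ^ 2)) := by ring
    have e4 : C ^ 2 * ε ^ 4 * ‖y‖ ^ 4 = (C * ε ^ 2 * ‖y‖ ^ 2) * (C * ε ^ 2 * ‖y‖ ^ 2) := by ring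
    rw [e3, e4]
    linarith
  have j3 : Integrable (fun y => a y * b y - (2 * n * C ^ 2 * ε ^ 3) * ‖y‖ ^ 3) γ :=
    iab.sub ((intble_norm_pow γ 3).const_mul _)
  rw [integral_sub j3
      ((intble_norm_pow γ 4).const_mul _), integral_sub iab ((intble_norm_pow γ 3).const_mul _),
      integral_const_mul, integral_const_mul, ← hm3, ← hm4] at lower
  have prod : (∫ y, R y ∂γ) * ∫ y, S y ∂γ ≤ (C * ε ^ 2 * m2) * (C * ε ^ 2 * m2) := by
    refine (le_abs_self _).trans ?_
    rw [abs_mul]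
    exact mul_le_mul bER bES (abs_nonneg _) ((abs_nonneg _).trans bER)
  rw [ER, ES] at covid
  have e43 : ε ^ 4 ≤ ε ^ 3 := pow_le_pow_of_le_one hε hε1 (by norm_num)
  have t1 : C ^ 2 * m4 * ε ^ 4 ≤ C ^ 2 * m4 * ε ^ 3 :=
    mul_le_mul_of_nonneg_left e43 (by positivity)
  have t2 : C ^ 2 * m2 ^ 2 * ε ^ 4 ≤ C ^ 2 * m2 ^ 2 * ε ^ 3 :=
    mul_le_mul_of_nonneg_left e43 (by positivity)
  nlinarith

lemma gauss_semigroup [IsGaussian γ] (hmean : ∀ i, ∫ y, y i ∂γ = 0) (a b c : ℝ)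
    (habc : a ^ 2 + b ^ 2 = c ^ 2) :
    (γ.prod γ).map (fun p : (ι → ℝ) × (ι → ℝ) => a • p.1 + b • p.2)
      = γ.map (fun y : ι → ℝ => c • y) := by
  have m1 : Measurable (fun p : (ι → ℝ) × (ι → ℝ) => a • p.1 + b • p.2) := by fun_prop
  have m2 : Measurable (fun y : ι → ℝ => c • y) := by fun_prop
  have := Measure.isProbabilityMeasure_map (μ := γ.prod γ) m1.aemeasurable
  have := Measure.isProbabilityMeasure_map (μ := γ) m2.aemeasurable
  have h0 : γ[id] = 0 := by
    funext i
    have h := IsGaussian.integral_dual (μ := γ) (ContinuousLinearMap.proj (R := ℝ) (φ := fun _ : ι => ℝ) i)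
    simp only [ContinuousLinearMap.proj_apply, hmean] at h
    exact h.symm
  have key : ∀ (d : ℝ) (L : StrongDual ℝ (ι → ℝ)),
      ∫ y, Complex.exp ((L (d • y) : ℝ) * Complex.I) ∂γ
        = Complex.exp (-(d ^ 2 * Var[L; γ] / 2 : ℝ)) := by
    intro d L
    have h := IsGaussian.charFunDual_eq_of_integral_eq_zero h0 (d • L)
    rw [charFunDual_apply] at h
    have hv : Var[⇑(d • L); γ] = d ^ 2 * Var[L; γ] := variance_const_mul d L γ
    rw [hv] at h
    simp only [map_smul]
    simp only [smul_apply] at h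
    rw [h]
    congr 1
    push_cast
    ring
  apply Measure.ext_of_charFunDual
  funext L
  rw [charFunDual_apply, charFunDual_apply, integral_map m1.aemeasurable (by fun_prop),
    integral_map m2.aemeasurable (by fun_prop), key c L]
  have : ∀ p : (ι → ℝ) × (ι → ℝ), Complex.exp ((L (a • p.1 + b • p.2) : ℝ) * Complex.I)
      = Complex.exp ((L (a • p.1) : ℝ) * Complex.I) * Complex.exp ((L (b • p.2) : ℝ) * Complex.I) := by
    intro p
    rw [← Complex.exp_add, map_add]
    push_cast
    ring_nf
  simp only [this]
  rw [integral_prod_mul (fun y : ι → ℝ => Complex.exp ((L (a • y) : ℝ) * Complex.I))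
    (fun y : ι → ℝ => Complex.exp ((L (b • y) : ℝ) * Complex.I)), key, key, ← Complex.exp_add,
    ← habc]
  congr 1
  push_cast
  ring

lemma iter_cont [IsProbabilityMeasure γ] {u : (ι → ℝ) → ℝ} {B : ℝ} (hu : Continuous u)
    (hb : ∀ x, |u x| ≤ B) (ε : ℝ) (k : ℕ) :
    Continuous ((smoothOp γ ε)^[k] u) ∧ ∀ x, |(smoothOp γ ε)^[k] u x| ≤ B := by
  induction k with
  | zero => exact ⟨hu, hb⟩
  | succ k ih =>
    rw [Function.iterate_succ_apply']
    exact ⟨smoothOp_cont γ ih.1 ih.2 ε, smoothOp_bdd γ ih.2 ε⟩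

lemma iter_good [IsProbabilityMeasure γ] {u : (ι → ℝ) → ℝ} {L : ι → (ι → ℝ) → ℝ} {C : ℝ}
    (h : Good C u L) (ε : ℝ) (k : ℕ) : ∃ L', Good C ((smoothOp γ ε)^[k] u) L' := by
  induction k with
  | zero => exact ⟨L, h⟩
  | succ k ih =>
    obtain ⟨L', h'⟩ := ih
    rw [Function.iterate_succ_apply']
    exact ⟨_, good_smoothOp γ h' ε⟩

lemma iter_eq [IsGaussian γ] (hmean : ∀ i, ∫ y, y i ∂γ = 0) {u : (ι → ℝ) → ℝ} {B : ℝ}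
    (hu : Continuous u) (hb : ∀ x, |u x| ≤ B) (ε : ℝ) (k : ℕ) (x : ι → ℝ) :
    (smoothOp γ ε)^[k] u x = smoothOp γ (√k * ε) u x := by
  induction k generalizing x with
  | zero => simp [smoothOp]
  | succ k ih =>
    rw [Function.iterate_succ_apply']
    have e : (smoothOp γ ε)^[k] u = smoothOp γ (√k * ε) u := funext ih
    rw [e]
    simp only [smoothOp]
    have m1 : Measurable (fun p : (ι → ℝ) × (ι → ℝ) => ε • p.1 + (√k * ε) • p.2) := by fun_prop
    have m2 : Measurable (fun y : ι → ℝ => (√(k + 1 : ℕ) * ε) • y) := by fun_prop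
    have hs := gauss_semigroup γ hmean ε (√k * ε) (√(k + 1 : ℕ) * ε) (by
      rw [mul_pow, mul_pow, Real.sq_sqrt (by positivity), Real.sq_sqrt (by positivity)]
      push_cast; ring)
    have e1 : ∫ z, u (x + z) ∂(γ.map (fun y : ι → ℝ => (√(k + 1 : ℕ) * ε) • y))
        = ∫ y, u (x + (√(k + 1 : ℕ) * ε) • y) ∂γ :=
      integral_map m2.aemeasurable (Continuous.aestronglyMeasurable (by fun_prop))
    rw [← e1, ← hs, integral_map m1.aemeasurable
      (Continuous.aestronglyMeasurable (by fun_prop)), integral_prod]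
    · simp only [add_assoc]
    · refine Integrable.of_bound (C := B) (Continuous.aestronglyMeasurable (by fun_prop)) ?_
      exact ae_of_all _ fun y => by simpa using hb _

lemma good_mul_bd {C : ℝ} {u v : (ι → ℝ) → ℝ} {L L'} (hu : Good C u L) (hv : Good C v L')
    (z : ι → ℝ) : |u z * v z| ≤ 1 := by
  rw [abs_mul]
  exact mul_le_one₀ (hu.bd z) (abs_nonneg _) (hv.bd z)

lemma pitt_smooth [IsGaussian γ] (hmean : ∀ i, ∫ y, y i ∂γ = 0)
    (hcov : ∀ i j, 0 ≤ ∫ y, y i * y j ∂γ) {C : ℝ} (hC : 0 ≤ C) {u v : (ι → ℝ) → ℝ} {L L'}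
    (hu : Good C u L) (hv : Good C v L') :
    (∫ y, u y ∂γ) * ∫ y, v y ∂γ ≤ ∫ y, u y * v y ∂γ := by
  obtain ⟨K, hK⟩ := step_lower γ hmean hcov hC
  have cuv : Continuous (fun z => u z * v z) := hu.cu.mul hv.cu
  have buv := good_mul_bd hu hv
  have iter : ∀ ε : ℝ, 0 ≤ ε → ε ≤ 1 → ∀ k : ℕ, ∀ x,
      (smoothOp γ ε)^[k] u x * (smoothOp γ ε)^[k] v x - k * (K * ε ^ 3)
        ≤ (smoothOp γ ε)^[k] (fun z => u z * v z) x := by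
    intro ε h0 h1 k
    induction k with
    | zero => intro x; simp
    | succ k ih =>
      intro x
      simp only [Function.iterate_succ_apply']
      obtain ⟨M, hM⟩ := iter_good γ hu ε k
      obtain ⟨M', hM'⟩ := iter_good γ hv ε k
      have s := hK ε h0 h1 _ _ _ _ hM hM' x
      have c := iter_cont γ cuv buv ε k
      have i1 : Integrable (fun y => (smoothOp γ ε)^[k] u (x + ε • y) *
          (smoothOp γ ε)^[k] v (x + ε • y)) γ :=
        intble_bdd γ (u := fun z => (smoothOp γ ε)^[k] u z * (smoothOp γ ε)^[k] v z)
          (hM.cu.mul hM'.cu) (good_mul_bd hM hM') ε x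
      have mono : smoothOp γ ε (fun z => (smoothOp γ ε)^[k] u z * (smoothOp γ ε)^[k] v z) x
          - k * (K * ε ^ 3) ≤ smoothOp γ ε ((smoothOp γ ε)^[k] (fun z => u z * v z)) x := by
        have : smoothOp γ ε (fun z => (smoothOp γ ε)^[k] u z * (smoothOp γ ε)^[k] v z) x
          - k * (K * ε ^ 3) = ∫ y, ((smoothOp γ ε)^[k] u (x + ε • y) *
          (smoothOp γ ε)^[k] v (x + ε • y) - k * (K * ε ^ 3)) ∂γ := by
          rw [integral_sub i1 (integrable_const _)]
          simp [smoothOp]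
        rw [this]
        exact integral_mono (i1.sub (integrable_const _)) (intble_bdd γ c.1 c.2 ε x)
          fun y => ih _
      push_cast
      linarith
  have fin : ∀ n : ℕ, (∫ y, u y ∂γ) * ∫ y, v y ∂γ - K * (√(n + 1 : ℕ))⁻¹ ≤ ∫ y, u y * v y ∂γ := by
    intro n
    have p1 : (1 : ℝ) ≤ √(n + 1 : ℕ) := by
      rw [Real.one_le_sqrt]; push_cast; linarith [Nat.cast_nonneg (α := ℝ) n]
    have p0 : (0 : ℝ) < √(n + 1 : ℕ) := by linarith
    have h := iter (√(n + 1 : ℕ))⁻¹ (by positivity) (inv_le_one_of_one_le₀ p1) (n + 1) 0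
    rw [iter_eq γ hmean hu.cu hu.bd, iter_eq γ hmean hv.cu hv.bd, iter_eq γ hmean cuv buv,
      mul_inv_cancel₀ p0.ne'] at h
    simp only [smoothOp, one_smul, zero_add] at h
    have e : ((n + 1 : ℕ) : ℝ) * (K * (√(n + 1 : ℕ))⁻¹ ^ 3) = K * (√(n + 1 : ℕ))⁻¹ := by
      have sq : ((n + 1 : ℕ) : ℝ) = √(n + 1 : ℕ) ^ 2 := (Real.sq_sqrt (by positivity)).symm
      rw [inv_pow]
      generalize √((n + 1 : ℕ) : ℝ) = r at *
      rw [sq]; field_simp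
    rwa [e] at h
  have lim : Tendsto (fun n : ℕ => (∫ y, u y ∂γ) * ∫ y, v y ∂γ - K * (√(n + 1 : ℕ))⁻¹) atTop
      (nhds ((∫ y, u y ∂γ) * ∫ y, v y ∂γ - K * 0)) := by
    refine tendsto_const_nhds.sub (tendsto_const_nhds.mul ?_)
    refine tendsto_inv_atTop_zero.comp (Real.tendsto_sqrt_atTop.comp ?_)
    exact tendsto_natCast_atTop_atTop.comp (tendsto_add_atTop_nat 1)
  have := le_of_tendsto' lim fin
  simpa using this

lemma good_one : Good 0 (fun _ : ι → ℝ => (1 : ℝ)) (fun _ _ => 0) where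
  bd := by simp
  cu := by fun_prop
  cL := by fun_prop
  Lneg := by simp
  Lbd := by simp
  tay := by simp

lemma Good.mono {C C' : ℝ} {u : (ι → ℝ) → ℝ} {L} (h : Good C u L) (hCC : C ≤ C') :
    Good C' u L where
  bd := h.bd
  cu := h.cu
  cL := h.cL
  Lneg := h.Lneg
  Lbd := fun i x => (h.Lbd i x).trans hCC
  tay := fun x k => (h.tay x k).trans (mul_le_mul_of_nonneg_right hCC (sq_nonneg _))

lemma Good.lip {C : ℝ} (hC : 0 ≤ C) {u : (ι → ℝ) → ℝ} {L} (h : Good C u L) (x k : ι → ℝ) :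
    |u (x + k) - u x| ≤ ((Fintype.card ι + 1) * C + 2) * ‖k‖ := by
  have n0 : (0 : ℝ) ≤ Fintype.card ι := Nat.cast_nonneg _
  have k0 := norm_nonneg k
  rcases le_total ‖k‖ 1 with hk | hk
  · have h1 := h.tay x k
    have h2 := lin_bound (fun i => L i x) (fun i => h.Lbd i x) k
    have h3 : |u (x + k) - u x| ≤ |u (x + k) - u x - ∑ i, L i x * k i| + |∑ i, L i x * k i| := by
      have := abs_add_le (u (x + k) - u x - ∑ i, L i x * k i) (∑ i, L i x * k i)
      simpa using this
    have h4 : C * ‖k‖ ^ 2 ≤ C * ‖k‖ := mul_le_mul_of_nonneg_left (by nlinarith) hC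
    nlinarith
  · have h1 := abs_le.1 (h.bd (x + k))
    have h2 := abs_le.1 (h.bd x)
    have h3 : |u (x + k) - u x| ≤ 2 := abs_le.2 ⟨by linarith, by linarith⟩
    have : 0 ≤ (Fintype.card ι + 1) * C := by positivity
    nlinarith

lemma Good.mul {C : ℝ} (hC : 0 ≤ C) {u v : (ι → ℝ) → ℝ} {L L'} (hu : Good C u L)
    (hv : Good C v L') (u0 : ∀ x, 0 ≤ u x) (v0 : ∀ x, 0 ≤ v x) :
    Good (((Fintype.card ι + 1) * C + 2) ^ 2 + 2 * C) (fun x => u x * v x)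
      (fun i x => u x * L' i x + v x * L i x) where
  bd := good_mul_bd hu hv
  cu := hu.cu.mul hv.cu
  cL := fun i => (hu.cu.mul (hv.cL i)).add (hv.cu.mul (hu.cL i))
  Lneg := fun i x => add_nonpos (mul_nonpos_of_nonneg_of_nonpos (u0 x) (hv.Lneg i x))
    (mul_nonpos_of_nonneg_of_nonpos (v0 x) (hu.Lneg i x))
  Lbd := fun i x => by
    refine (abs_add_le _ _).trans ?_
    rw [abs_mul, abs_mul]
    have h1 : |u x| * |L' i x| ≤ 1 * C := mul_le_mul (hu.bd x) (hv.Lbd i x) (abs_nonneg _) (by simp)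
    have h2 : |v x| * |L i x| ≤ 1 * C := mul_le_mul (hv.bd x) (hu.Lbd i x) (abs_nonneg _) (by simp)
    nlinarith [sq_nonneg (((Fintype.card ι : ℝ) + 1) * C + 2)]
  tay := fun x k => by
    have e : u (x + k) * v (x + k) - u x * v x - ∑ i, (u x * L' i x + v x * L i x) * k i
      = (u (x + k) - u x) * (v (x + k) - v x) + u x * (v (x + k) - v x - ∑ i, L' i x * k i)
        + v x * (u (x + k) - u x - ∑ i, L i x * k i) := by
      have : ∑ i, (u x * L' i x + v x * L i x) * k i
        = u x * ∑ i, L' i x * k i + v x * ∑ i, L i x * k i := by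
        rw [Finset.mul_sum, Finset.mul_sum, ← Finset.sum_add_distrib]
        exact Finset.sum_congr rfl fun i _ => by ring
      rw [this]; ring
    rw [e]
    have h1 : |(u (x + k) - u x) * (v (x + k) - v x)| ≤
        (((Fintype.card ι + 1) * C + 2) * ‖k‖) * (((Fintype.card ι + 1) * C + 2) * ‖k‖) := by
      rw [abs_mul]
      exact mul_le_mul (hu.lip hC x k) (hv.lip hC x k) (abs_nonneg _)
        ((abs_nonneg _).trans (hu.lip hC x k))
    have h2 : |u x * (v (x + k) - v x - ∑ i, L' i x * k i)| ≤ 1 * (C * ‖k‖ ^ 2) := by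
      rw [abs_mul]
      exact mul_le_mul (hu.bd x) (hv.tay x k) (abs_nonneg _) (by simp)
    have h3 : |v x * (u (x + k) - u x - ∑ i, L i x * k i)| ≤ 1 * (C * ‖k‖ ^ 2) := by
      rw [abs_mul]
      exact mul_le_mul (hv.bd x) (hu.tay x k) (abs_nonneg _) (by simp)
    refine (abs_add_le _ _).trans ((add_le_add (abs_add_le _ _) le_rfl).trans
      ((add_le_add (add_le_add h1 h2) h3).trans (le_of_eq ?_)))
    ring

lemma sigmoid_lip (a b : ℝ) : |Real.sigmoid a - Real.sigmoid b| ≤ |a - b| := by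
  have := Convex.norm_image_sub_le_of_norm_hasDerivWithin_le (f := Real.sigmoid)
    (f' := fun x => Real.sigmoid x * (1 - Real.sigmoid x)) (C := 1) (s := univ) (x := b) (y := a)
    (fun x _ => (Real.hasDerivAt_sigmoid x).hasDerivWithinAt)
    (fun x _ => by
      have h0 := Real.sigmoid_nonneg x
      have h1 := Real.sigmoid_le_one x
      rw [Real.norm_eq_abs, abs_le]; constructor <;> nlinarith) convex_univ trivial trivial
  simpa using this

lemma sigmoid_taylor (a h : ℝ) :
    |Real.sigmoid (a + h) - Real.sigmoid a - Real.sigmoid a * (1 - Real.sigmoid a) * h| ≤ h ^ 2 := by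
  have key := Convex.norm_image_sub_le_of_norm_hasDerivWithin_le
    (f := fun t => Real.sigmoid t - Real.sigmoid a * (1 - Real.sigmoid a) * t)
    (f' := fun x => Real.sigmoid x * (1 - Real.sigmoid x) - Real.sigmoid a * (1 - Real.sigmoid a))
    (C := |h|) (s := uIcc a (a + h)) (x := a) (y := a + h)
    (fun x _ => by
      have := (Real.hasDerivAt_sigmoid x).sub
        ((hasDerivAt_id x).const_mul (Real.sigmoid a * (1 - Real.sigmoid a)))
      exact (this.congr_deriv (by simp)).hasDerivWithinAt)
    (fun x hx => by
      have h0 := Real.sigmoid_nonneg x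
      have h1 := Real.sigmoid_le_one x
      have h0' := Real.sigmoid_nonneg a
      have h1' := Real.sigmoid_le_one a
      have hl := sigmoid_lip x a
      have hxa : |x - a| ≤ |h| := by
        have := abs_sub_left_of_mem_uIcc hx
        simpa using this
      have e : Real.sigmoid x * (1 - Real.sigmoid x) - Real.sigmoid a * (1 - Real.sigmoid a)
        = (Real.sigmoid x - Real.sigmoid a) * (1 - Real.sigmoid x - Real.sigmoid a) := by ring
      rw [e, Real.norm_eq_abs, abs_mul]
      have : |1 - Real.sigmoid x - Real.sigmoid a| ≤ 1 := abs_le.2 ⟨by linarith, by linarith⟩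
      calc _ ≤ |Real.sigmoid x - Real.sigmoid a| * 1 :=
            mul_le_mul_of_nonneg_left this (abs_nonneg _)
        _ ≤ _ := by linarith)
    (convex_uIcc _ _) left_mem_uIcc right_mem_uIcc
  simp only [Real.norm_eq_abs] at key
  rw [add_sub_cancel_left, ← pow_two, sq_abs] at key
  refine le_trans (le_of_eq ?_) key
  congr 1; ring

lemma good_coord [DecidableEq ι] (p q : ℝ) (hq : 0 ≤ q) (i : ι) :
    Good (q + q ^ 2) (fun x : ι → ℝ => Real.sigmoid (p - q * x i))
      (fun j x => if j = i then -q * (Real.sigmoid (p - q * x i) *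
        (1 - Real.sigmoid (p - q * x i))) else 0) where
  bd := fun x => abs_le.2 ⟨by linarith [Real.sigmoid_nonneg (p - q * x i)], Real.sigmoid_le_one _⟩
  cu := continuous_sigmoid.comp (by fun_prop)
  cL := fun j => by
    have : Continuous fun x : ι → ℝ => Real.sigmoid (p - q * x i) :=
      continuous_sigmoid.comp (by fun_prop)
    split_ifs
    · fun_prop
    · fun_prop
  Lneg := fun j x => by
    have h0 := Real.sigmoid_nonneg (p - q * x i)
    have h1 := Real.sigmoid_le_one (p - q * x i)
    split_ifs
    · have := mul_nonneg hq (mul_nonneg h0 (sub_nonneg.2 h1)); linarith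
    · exact le_rfl
  Lbd := fun j x => by
    have h0 := Real.sigmoid_nonneg (p - q * x i)
    have h1 := Real.sigmoid_le_one (p - q * x i)
    split_ifs
    · have h2 := mul_nonneg hq (mul_nonneg h0 (sub_nonneg.2 h1))
      have h3 : q * (Real.sigmoid (p - q * x i) * (1 - Real.sigmoid (p - q * x i))) ≤ q * 1 :=
        mul_le_mul_of_nonneg_left (by nlinarith) hq
      rw [abs_le]; constructor <;> nlinarith
    · simp; positivity
  tay := fun x k => by
    have h := sigmoid_taylor (p - q * x i) (-q * k i)
    have e : p - q * (x + k) i = p - q * x i + -q * k i := by simp; ring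
    simp only [ite_mul, zero_mul, Finset.sum_ite_eq', Finset.mem_univ, if_true]
    rw [e]
    have hk : k i ^ 2 ≤ ‖k‖ ^ 2 := by
      rw [← sq_abs]
      exact pow_le_pow_left₀ (abs_nonneg _) (norm_le_pi_norm k i) 2
    calc _ ≤ (-q * k i) ^ 2 := by
          refine le_trans (le_of_eq ?_) h
          congr 1; ring
      _ = q ^ 2 * k i ^ 2 := by ring
      _ ≤ (q + q ^ 2) * ‖k‖ ^ 2 :=
        mul_le_mul (by linarith) hk (sq_nonneg _) (by positivity)

lemma good_prod (p q : ℝ) (hq : 0 ≤ q) (A : Finset ι) :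
    ∃ C L, 0 ≤ C ∧ Good C (fun x : ι → ℝ => ∏ i ∈ A, Real.sigmoid (p - q * x i)) L := by
  classical
  induction A using Finset.induction_on with
  | empty => exact ⟨0, _, le_rfl, by simpa using good_one⟩
  | insert i A hi ih =>
    obtain ⟨C, L, hC, hL⟩ := ih
    have h1 := (good_coord p q hq i).mono (show q + q ^ 2 ≤ C + (q + q ^ 2) by linarith)
    have h2 := hL.mono (show C ≤ C + (q + q ^ 2) by nlinarith [sq_nonneg q])
    have hC' : 0 ≤ C + (q + q ^ 2) := by positivity
    have h3 := Good.mul hC' h1 h2 (fun x => Real.sigmoid_nonneg _)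
        (fun x => Finset.prod_nonneg fun j _ => Real.sigmoid_nonneg _)
    simp only [Finset.prod_insert hi]
    exact ⟨_, _, by positivity, h3⟩

lemma sig_tendsto (a x : ℝ) :
    Tendsto (fun n : ℕ => Real.sigmoid (((n : ℝ) ^ 2 * a - n) - (n : ℝ) ^ 2 * x)) atTop
      (nhds (if x < a then (1 : ℝ) else 0)) := by
  have e : ∀ n : ℕ, ((n : ℝ) ^ 2 * a - n) - (n : ℝ) ^ 2 * x = n * (n * (a - x) - 1) := by
    intro n; ring
  simp only [e]
  have hn : Tendsto (fun n : ℕ => (n : ℝ)) atTop atTop := tendsto_natCast_atTop_atTop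
  split_ifs with h
  · refine Real.tendsto_sigmoid_atTop.comp (hn.atTop_mul_atTop₀ ?_)
    exact tendsto_atTop_add_const_right _ _ (hn.atTop_mul_const (by linarith))
  · refine Real.tendsto_sigmoid_atBot.comp ?_
    refine tendsto_atBot_mono (fun n => ?_) (tendsto_neg_atTop_atBot.comp hn)
    have h0 : (0 : ℝ) ≤ n := Nat.cast_nonneg _
    have : (n : ℝ) * (n * (x - a)) ≥ 0 := mul_nonneg h0 (mul_nonneg h0 (by linarith))
    simp only [Function.comp]
    nlinarith

lemma pitt_ind [IsGaussian γ] (hmean : ∀ i, ∫ y, y i ∂γ = 0)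
    (hcov : ∀ i j, 0 ≤ ∫ y, y i * y j ∂γ) (a : ℝ) (A B : Finset ι) :
    γ.real {x | ∀ i ∈ A, x i < a} * γ.real {x | ∀ i ∈ B, x i < a}
      ≤ γ.real {x | (∀ i ∈ A, x i < a) ∧ ∀ i ∈ B, x i < a} := by
  classical
  set g : Finset ι → ℕ → (ι → ℝ) → ℝ := fun A n x =>
    ∏ i ∈ A, Real.sigmoid (((n : ℝ) ^ 2 * a - n) - (n : ℝ) ^ 2 * x i) with hg
  have g1 : ∀ A n x, |g A n x| ≤ 1 := fun A n x => by
    rw [abs_of_nonneg (Finset.prod_nonneg fun j _ => Real.sigmoid_nonneg _)]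
    exact Finset.prod_le_one (fun j _ => Real.sigmoid_nonneg _) fun j _ => Real.sigmoid_le_one _
  have gc : ∀ A n, Continuous (g A n) := fun A n => by
    simp only [hg]
    exact continuous_finsetProd _ fun i _ => continuous_sigmoid.comp (by fun_prop)
  have gt : ∀ A x, Tendsto (fun n => g A n x) atTop (nhds (if ∀ i ∈ A, x i < a then 1 else 0)) := by
    intro A x
    have := tendsto_finsetProd A fun i (_ : i ∈ A) => sig_tendsto a (x i)
    rw [Finset.prod_ite_zero] at this
    simpa using this
  have ms : ∀ A : Finset ι, MeasurableSet {x : ι → ℝ | ∀ i ∈ A, x i < a} := fun A => by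
    have : {x : ι → ℝ | ∀ i ∈ A, x i < a} = ⋂ i ∈ A, {x | x i < a} := by ext; simp
    rw [this]
    exact Finset.measurableSet_biInter _ fun i _ => measurableSet_lt (by fun_prop) (by fun_prop)
  have lim1 : ∀ A, Tendsto (fun n => ∫ x, g A n x ∂γ) atTop
      (nhds (γ.real {x | ∀ i ∈ A, x i < a})) := by
    intro A
    rw [← integral_indicator_one (ms A)]
    refine tendsto_integral_of_dominated_convergence (fun _ => 1)
      (fun n => (gc A n).aestronglyMeasurable) (integrable_const _)
      (fun n => ae_of_all _ fun x => by simpa using g1 A n x) (ae_of_all _ fun x => ?_)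
    simpa [indicator_apply] using gt A x
  have lim2 : Tendsto (fun n => ∫ x, g A n x * g B n x ∂γ) atTop
      (nhds (γ.real {x | (∀ i ∈ A, x i < a) ∧ ∀ i ∈ B, x i < a})) := by
    have ms2 : MeasurableSet {x : ι → ℝ | (∀ i ∈ A, x i < a) ∧ ∀ i ∈ B, x i < a} :=
      (ms A).inter (ms B)
    rw [← integral_indicator_one ms2]
    refine tendsto_integral_of_dominated_convergence (fun _ => 1)
      (fun n => ((gc A n).mul (gc B n)).aestronglyMeasurable) (integrable_const _)
      (fun n => ae_of_all _ fun x => ?_) (ae_of_all _ fun x => ?_)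
    · rw [norm_mul]
      exact mul_le_one₀ (g1 A n x) (norm_nonneg _) (g1 B n x)
    · have := (gt A x).mul (gt B x)
      rw [ite_zero_mul_ite_zero] at this
      simpa [indicator_apply] using this
  refine le_of_tendsto_of_tendsto' ((lim1 A).mul (lim1 B)) lim2 fun n => ?_
  obtain ⟨C, L, hC, hL⟩ := good_prod ((n : ℝ) ^ 2 * a - n) ((n : ℝ) ^ 2) (by positivity) A
  obtain ⟨C', L', hC', hL'⟩ := good_prod ((n : ℝ) ^ 2 * a - n) ((n : ℝ) ^ 2) (by positivity) B
  exact pitt_smooth γ hmean hcov (add_nonneg hC hC') (hL.mono (by linarith))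
    (hL'.mono (by linarith))

end

lemma gauss_mean_zero {ι : Type*} [Fintype ι] (γ : Measure (ι → ℝ)) [IsGaussian γ]
    (hmean : ∀ i, ∫ y, y i ∂γ = 0) : γ[id] = 0 := by
  funext i
  have h := IsGaussian.integral_dual (μ := γ)
    (ContinuousLinearMap.proj (R := ℝ) (φ := fun _ : ι => ℝ) i)
  simp only [ContinuousLinearMap.proj_apply, hmean] at h
  exact h.symm

lemma dual_apply_sum {ι : Type*} [Fintype ι] [DecidableEq ι] (L : StrongDual ℝ (ι → ℝ))
    (y : ι → ℝ) : L y = ∑ i, L (Pi.single i 1) * y i := by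
  conv_lhs => rw [pi_eq_sum_univ' y]
  rw [map_sum]
  refine Finset.sum_congr rfl fun i _ => ?_
  rw [map_smul, smul_eq_mul, mul_comm]

lemma gauss_ext {ι : Type*} [Fintype ι] (γ γ' : Measure (ι → ℝ)) [IsGaussian γ] [IsGaussian γ']
    (hmean : ∀ i, ∫ y, y i ∂γ = 0) (hmean' : ∀ i, ∫ y, y i ∂γ' = 0)
    (hc : ∀ i j, ∫ y, y i * y j ∂γ = ∫ y, y i * y j ∂γ') : γ = γ' := by
  classical
  have h0 := gauss_mean_zero γ hmean
  have h0' := gauss_mean_zero γ' hmean'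
  have key : ∀ (ν : Measure (ι → ℝ)) [IsGaussian ν] (_ : ν[id] = 0) (L : StrongDual ℝ (ι → ℝ)),
      Var[L; ν] = ∑ i, ∑ j, L (Pi.single i 1) * L (Pi.single j 1) * ∫ y, y i * y j ∂ν := by
    intro ν _ hν L
    have hm : ν[L] = 0 := by
      rw [IsGaussian.integral_dual]
      have : ∫ x, x ∂ν = 0 := hν
      rw [this, map_zero]
    rw [variance_of_integral_eq_zero (by fun_prop) hm]
    have e : ∀ y, L y ^ 2 = ∑ i, ∑ j, L (Pi.single i 1) * L (Pi.single j 1) * (y i * y j) := by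
      intro y
      rw [dual_apply_sum L y, pow_two, Finset.sum_mul_sum]
      exact Finset.sum_congr rfl fun i _ => Finset.sum_congr rfl fun j _ => by ring
    simp only [e]
    rw [integral_finsetSum _ fun i _ =>
      integrable_finsetSum _ fun j _ => (intble_coord2 ν i j).const_mul _]
    refine Finset.sum_congr rfl fun i _ => ?_
    rw [integral_finsetSum _ fun j _ => (intble_coord2 ν i j).const_mul _]
    exact Finset.sum_congr rfl fun j _ => integral_const_mul _ _
  apply Measure.ext_of_charFunDual
  funext L
  rw [IsGaussian.charFunDual_eq_of_integral_eq_zero h0,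
    IsGaussian.charFunDual_eq_of_integral_eq_zero h0', key γ h0, key γ' h0']
  simp only [hc]

section process
variable {Ω : Type*} [MeasurableSpace Ω] {μ : Measure Ω} [IsProbabilityMeasure μ]
  {Z : ℝ → Ω → ℝ}

lemma proc_map (hG : IsCenteredGaussianProcess μ Z) (t : ℝ) :
    ∃ v, μ.map (Z t) = gaussianReal 0 v := by
  obtain ⟨v, hv⟩ := hG 1 (fun _ => 1) (fun _ => t)
  exact ⟨v, by simpa using hv⟩

lemma proc_aem (hG : IsCenteredGaussianProcess μ Z) (t : ℝ) : AEMeasurable (Z t) μ := by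
  obtain ⟨v, hv⟩ := proc_map hG t
  by_contra h
  rw [Measure.map_of_not_aemeasurable h] at hv
  exact IsProbabilityMeasure.ne_zero (gaussianReal 0 v) hv.symm

lemma vec_aem (hG : IsCenteredGaussianProcess μ Z) {ι : Type*} [Fintype ι] (t : ι → ℝ) :
    AEMeasurable (fun ω i => Z (t i) ω) μ :=
  aemeasurable_pi_lambda _ fun i => proc_aem hG (t i)

lemma vec_gauss (hG : IsCenteredGaussianProcess μ Z) {ι : Type*} [Fintype ι] (t : ι → ℝ) :
    IsGaussian (μ.map (fun ω i => Z (t i) ω)) := by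
  classical
  refine isGaussian_of_map_eq_gaussianReal fun L => ?_
  rw [AEMeasurable.map_map_of_aemeasurable (by fun_prop) (vec_aem hG t)]
  let e := Fintype.equivFin ι
  obtain ⟨v, hv⟩ := hG (Fintype.card ι) (fun i => L (Pi.single (e.symm i) 1))
    (fun i => t (e.symm i))
  refine ⟨0, v, ?_⟩
  rw [← hv]
  congr 1
  funext ω
  simp only [Function.comp]
  rw [dual_apply_sum L]
  exact (Equiv.sum_comp e.symm fun i => L (Pi.single i 1) * Z (t i) ω).symm

lemma vec_mean (hG : IsCenteredGaussianProcess μ Z) {ι : Type*} [Fintype ι] (t : ι → ℝ) (i : ι) :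
    ∫ y, y i ∂(μ.map (fun ω i => Z (t i) ω)) = 0 := by
  rw [integral_map (vec_aem hG t) (measurable_pi_apply i).aestronglyMeasurable]
  obtain ⟨v, hv⟩ := proc_map hG (t i)
  have := integral_map (proc_aem hG (t i)) (f := fun x : ℝ => x) (by fun_prop)
  rw [← this, hv]
  exact integral_id_gaussianReal

lemma vec_cov (hG : IsCenteredGaussianProcess μ Z) {ρ : ℝ → ℝ}
    (hcov : ∀ s t : ℝ, (∫ ω, Z s ω * Z t ω ∂μ) = ρ (t - s))
    {ι : Type*} [Fintype ι] (t : ι → ℝ) (i j : ι) :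
    ∫ y, y i * y j ∂(μ.map (fun ω i => Z (t i) ω)) = ρ (t j - t i) := by
  rw [integral_map (vec_aem hG t) (by fun_prop)]
  exact hcov _ _

lemma ms_fin {ι : Type*} [Fintype ι] (a : ℝ) (A : Finset ι) :
    MeasurableSet {x : ι → ℝ | ∀ i ∈ A, x i < a} := by
  have : {x : ι → ℝ | ∀ i ∈ A, x i < a} = ⋂ i ∈ A, {x | x i < a} := by ext; simp
  rw [this]
  exact Finset.measurableSet_biInter _ fun i _ => measurableSet_lt (by fun_prop) (by fun_prop)

lemma fin_assoc (hG : IsCenteredGaussianProcess μ Z) {ρ : ℝ → ℝ}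
    (hcov : ∀ s t : ℝ, (∫ ω, Z s ω * Z t ω ∂μ) = ρ (t - s)) (hnonneg : ∀ τ : ℝ, 0 ≤ ρ τ)
    (a : ℝ) (N : ℕ) (s t : ℕ → ℝ) :
    μ.real {ω | ∀ i < N, Z (s i) ω < a} * μ.real {ω | ∀ i < N, Z (t i) ω < a}
      ≤ μ.real {ω | (∀ i < N, Z (s i) ω < a) ∧ ∀ i < N, Z (t i) ω < a} := by
  classical
  set r : Fin N ⊕ Fin N → ℝ := Sum.elim (fun i => s i) (fun i => t i) with hr
  have := vec_gauss hG r
  have h := pitt_ind (μ.map (fun ω i => Z (r i) ω)) (vec_mean hG r)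
    (fun i j => by rw [vec_cov hG hcov]; exact hnonneg _) a
    (Finset.univ.image Sum.inl) (Finset.univ.image Sum.inr)
  have ms2 : MeasurableSet {x : Fin N ⊕ Fin N → ℝ | (∀ i ∈ Finset.univ.image Sum.inl, x i < a) ∧
      ∀ i ∈ Finset.univ.image Sum.inr, x i < a} := (ms_fin a _).inter (ms_fin a _)
  simp only [Measure.real] at h ⊢
  rw [Measure.map_apply_of_aemeasurable (vec_aem hG r) (ms_fin a _),
    Measure.map_apply_of_aemeasurable (vec_aem hG r) (ms_fin a _),
    Measure.map_apply_of_aemeasurable (vec_aem hG r) ms2] at h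
  simp only [Set.preimage_setOf_eq, Finset.forall_mem_image, Finset.mem_univ, true_imp_iff,
    forall_const, hr, Sum.elim_inl, Sum.elim_inr] at h
  simp only [Fin.forall_iff] at h
  exact h

lemma fin_shift (hG : IsCenteredGaussianProcess μ Z) {ρ : ℝ → ℝ}
    (hcov : ∀ s t : ℝ, (∫ ω, Z s ω * Z t ω ∂μ) = ρ (t - s))
    (a c : ℝ) (N : ℕ) (s : ℕ → ℝ) :
    μ.real {ω | ∀ i < N, Z (c + s i) ω < a} = μ.real {ω | ∀ i < N, Z (s i) ω < a} := by
  have := vec_gauss hG (fun i : Fin N => c + s i)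
  have := vec_gauss hG (fun i : Fin N => s i)
  have h := gauss_ext (μ.map (fun ω (i : Fin N) => Z (c + s i) ω))
    (μ.map (fun ω (i : Fin N) => Z (s i) ω)) (vec_mean hG _) (vec_mean hG (fun i : Fin N => s i))
    (fun i j => by
      rw [vec_cov hG hcov (fun i : Fin N => c + s i), vec_cov hG hcov (fun i : Fin N => s i)]
      congr 1; ring)
  have h2 := congrArg (fun ν => ν.real {x : Fin N → ℝ | ∀ i ∈ Finset.univ, x i < a}) h
  simp only [Measure.real] at h2 ⊢
  rw [Measure.map_apply_of_aemeasurable (vec_aem hG (fun i : Fin N => c + s i)) (ms_fin a _),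
    Measure.map_apply_of_aemeasurable (vec_aem hG (fun i : Fin N => s i)) (ms_fin a _)] at h2
  simpa [Fin.forall_iff] using h2

lemma nm_fin (hG : IsCenteredGaussianProcess μ Z) (a : ℝ) (N : ℕ) (s : ℕ → ℝ) :
    NullMeasurableSet {ω | ∀ i < N, Z (s i) ω < a} μ := by
  have : {ω | ∀ i < N, Z (s i) ω < a} = ⋂ i ∈ Iio N, {ω | Z (s i) ω < a} := by ext; simp
  rw [this]
  exact NullMeasurableSet.biInter (to_countable _) fun i _ =>
    nullMeasurableSet_lt (proc_aem hG _) aemeasurable_const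

lemma tend_fin (hG : IsCenteredGaussianProcess μ Z) (a : ℝ) (s : ℕ → ℝ) :
    Tendsto (fun N : ℕ => μ.real {ω | ∀ i < N, Z (s i) ω < a}) atTop
      (nhds (μ.real {ω | ∀ i, Z (s i) ω < a})) := by
  have e : {ω | ∀ i, Z (s i) ω < a} = ⋂ N : ℕ, {ω | ∀ i < N, Z (s i) ω < a} := by
    ext ω
    simp only [mem_setOf_eq, mem_iInter]
    exact ⟨fun h N i _ => h i, fun h i => h (i + 1) i (Nat.lt_succ_self i)⟩
  rw [e]
  refine (ENNReal.tendsto_toReal (measure_ne_top _ _)).comp ?_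
  refine tendsto_measure_iInter_atTop (fun N => nm_fin hG a N s) ?_ ⟨0, measure_ne_top _ _⟩
  intro N M h ω hω i hi
  exact hω i (lt_of_lt_of_le hi h)

lemma tend_fin2 (hG : IsCenteredGaussianProcess μ Z) (a : ℝ) (s t : ℕ → ℝ) :
    Tendsto (fun N : ℕ => μ.real {ω | (∀ i < N, Z (s i) ω < a) ∧ ∀ i < N, Z (t i) ω < a}) atTop
      (nhds (μ.real {ω | (∀ i, Z (s i) ω < a) ∧ ∀ i, Z (t i) ω < a})) := by
  have e : {ω | (∀ i, Z (s i) ω < a) ∧ ∀ i, Z (t i) ω < a}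
      = ⋂ N : ℕ, {ω | (∀ i < N, Z (s i) ω < a) ∧ ∀ i < N, Z (t i) ω < a} := by
    ext ω
    simp only [mem_setOf_eq, mem_iInter]
    exact ⟨fun h N => ⟨fun i _ => h.1 i, fun i _ => h.2 i⟩, fun h =>
      ⟨fun i => (h (i + 1)).1 i (Nat.lt_succ_self i), fun i => (h (i + 1)).2 i (Nat.lt_succ_self i)⟩⟩
  rw [e]
  refine (ENNReal.tendsto_toReal (measure_ne_top _ _)).comp ?_
  refine tendsto_measure_iInter_atTop (fun N => (nm_fin hG a N s).inter (nm_fin hG a N t)) ?_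
    ⟨0, measure_ne_top _ _⟩
  intro N M h ω hω
  exact ⟨fun i hi => hω.1 i (lt_of_lt_of_le hi h), fun i hi => hω.2 i (lt_of_lt_of_le hi h)⟩

lemma seq_assoc (hG : IsCenteredGaussianProcess μ Z) {ρ : ℝ → ℝ}
    (hcov : ∀ s t : ℝ, (∫ ω, Z s ω * Z t ω ∂μ) = ρ (t - s)) (hnonneg : ∀ τ : ℝ, 0 ≤ ρ τ)
    (a c : ℝ) (s t : ℕ → ℝ) :
    μ.real {ω | ∀ i, Z (s i) ω < a} * μ.real {ω | ∀ i, Z (t i) ω < a}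
      ≤ μ.real {ω | (∀ i, Z (s i) ω < a) ∧ ∀ i, Z (c + t i) ω < a} := by
  refine le_of_tendsto_of_tendsto' ((tend_fin hG a s).mul (tend_fin hG a t))
    (tend_fin2 hG a s (fun i => c + t i)) fun N => ?_
  rw [← fin_shift hG hcov a c N t]
  exact fin_assoc hG hcov hnonneg a N s (fun i => c + t i)

def unitSeq (n : ℕ) : ℝ := (TopologicalSpace.denseSeq (Icc (0 : ℝ) 1) n : ℝ)

lemma dense_le {f : ℝ → ℝ} (hf : Continuous f) {a c S : ℝ} (hS : 0 ≤ S)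
    (h : ∀ n, f (c + S * unitSeq n) < a) : ∀ t ∈ Icc c (c + S), f t ≤ a := by
  have hd := TopologicalSpace.denseRange_denseSeq (Icc (0 : ℝ) 1)
  have hall : ∀ s : Icc (0 : ℝ) 1, f (c + S * (s : ℝ)) ≤ a := by
    intro s
    have hc : IsClosed {s : Icc (0 : ℝ) 1 | f (c + S * (s : ℝ)) ≤ a} :=
      isClosed_le (by fun_prop) (by fun_prop)
    refine hd.induction_on (p := fun s => f (c + S * (s : ℝ)) ≤ a) s hc fun n => (h n).le
  intro t ht
  rcases hS.eq_or_lt with rfl | hS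
  · have := hall ⟨0, by simp⟩
    have e : t = c := le_antisymm (by simpa using ht.2) ht.1
    simpa [e] using this
  · have := hall ⟨(t - c) / S, ⟨div_nonneg (by linarith [ht.1]) hS.le,
      (div_le_one hS).2 (by linarith [ht.2])⟩⟩
    have e : c + S * ((t - c) / S) = t := by field_simp; ring
    simpa [e] using this

lemma persist_tendsto (hcont : ∀ ω, Continuous fun t => Z t ω) {T : ℝ} (hT : 0 ≤ T) :
    Tendsto (fun k : ℕ => μ.real {ω | ∀ i, Z (T * unitSeq i) ω < -(1 / ((k : ℝ) + 1))}) atTop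
      (nhds (μ.real {ω | ∀ t ∈ Icc (0 : ℝ) T, Z t ω < 0})) := by
  have e : {ω | ∀ t ∈ Icc (0 : ℝ) T, Z t ω < 0}
      = ⋃ k : ℕ, {ω | ∀ i, Z (T * unitSeq i) ω < -(1 / ((k : ℝ) + 1))} := by
    ext ω
    simp only [mem_setOf_eq, mem_iUnion]
    constructor
    · intro h
      obtain ⟨t0, ht0, hmax⟩ := isCompact_Icc.exists_isMaxOn (nonempty_Icc.2 hT)
        (hcont ω).continuousOn
      obtain ⟨k, hk⟩ := exists_nat_one_div_lt (neg_pos.2 (h t0 ht0))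
      refine ⟨k, fun i => ?_⟩
      have hu := (TopologicalSpace.denseSeq (Icc (0 : ℝ) 1) i).2
      have : Z (T * unitSeq i) ω ≤ Z t0 ω := hmax (show T * unitSeq i ∈ Icc 0 T from
        ⟨mul_nonneg hT hu.1, mul_le_of_le_one_right hT hu.2⟩)
      linarith
    · rintro ⟨k, hk⟩ t ht
      have := dense_le (hcont ω) (c := 0) hT (by simpa using hk) t (by simpa using ht)
      have hp : 0 < ((k : ℝ) + 1)⁻¹ := by positivity
      linarith
  rw [e]
  refine (ENNReal.tendsto_toReal (measure_ne_top _ _)).comp (tendsto_measure_iUnion_atTop ?_)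
  intro k l hkl ω hω i
  refine (hω i).trans_le (neg_le_neg ?_)
  exact one_div_le_one_div_of_le (by positivity) (by gcongr)

lemma persist_super (hG : IsCenteredGaussianProcess μ Z)
    (hcont : ∀ ω, Continuous fun t => Z t ω) {ρ : ℝ → ℝ}
    (hcov : ∀ s t : ℝ, (∫ ω, Z s ω * Z t ω ∂μ) = ρ (t - s)) (hnonneg : ∀ τ : ℝ, 0 ≤ ρ τ)
    {S T : ℝ} (hS : 0 ≤ S) (hT : 0 ≤ T) :
    μ.real {ω | ∀ t ∈ Icc (0 : ℝ) S, Z t ω < 0} * μ.real {ω | ∀ t ∈ Icc (0 : ℝ) T, Z t ω < 0}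
      ≤ μ.real {ω | ∀ t ∈ Icc (0 : ℝ) (S + T), Z t ω < 0} := by
  refine le_of_tendsto' ((persist_tendsto hcont hS).mul (persist_tendsto hcont hT)) fun k => ?_
  refine (seq_assoc hG hcov hnonneg _ S (fun i => S * unitSeq i) (fun i => T * unitSeq i)).trans ?_
  refine measureReal_mono ?_
  rintro ω ⟨h1, h2⟩ t ht
  have hp : 0 < ((k : ℝ) + 1)⁻¹ := by positivity
  rcases le_total t S with h | h
  · have := dense_le (hcont ω) (c := 0) hS (by simpa using h1) t ⟨ht.1, by simpa using h⟩
    linarith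
  · have := dense_le (hcont ω) (c := S) hT h2 t ⟨h, ht.2⟩
    rw [one_div] at this
    linarith

end process

lemma fekete_real (p : ℝ → ℝ) (hp1 : ∀ T, p T ≤ 1) (hp0 : ∀ T, 0 ≤ p T) (hanti : Antitone p)
    (hsup : ∀ S T, 0 ≤ S → 0 ≤ T → p S * p T ≤ p (S + T)) :
    ∃ l : ℝ, l ≤ 0 ∧ Tendsto (fun T : ℝ => (1 / T) * Real.log (p T)) atTop (nhds l) := by
  by_cases hz : ∃ T, p T = 0
  · obtain ⟨T0, hT0⟩ := hz
    refine ⟨0, le_rfl, tendsto_const_nhds.congr' ?_⟩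
    filter_upwards [eventually_ge_atTop T0] with T hT
    have : p T = 0 := le_antisymm (hT0 ▸ hanti hT) (hp0 T)
    simp [this]
  · push Not at hz
    have pos : ∀ T, 0 < p T := fun T => lt_of_le_of_ne (hp0 T) (hz T).symm
    set u : ℕ → ℝ := fun n => -Real.log (p n) with hu
    have un : ∀ n, 0 ≤ u n := fun n => neg_nonneg.2 (Real.log_nonpos (hp0 _) (hp1 _))
    have sub : Subadditive u := by
      intro m n
      simp only [hu]
      have h := Real.log_le_log (mul_pos (pos m) (pos n))
        (hsup m n (Nat.cast_nonneg _) (Nat.cast_nonneg _))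
      rw [Real.log_mul (pos _).ne' (pos _).ne'] at h
      push_cast
      linarith
    have bdd : BddBelow (range fun n : ℕ => u n / n) := ⟨0, by
      rintro _ ⟨n, rfl⟩
      exact div_nonneg (un n) (Nat.cast_nonneg _)⟩
    have lim := sub.tendsto_lim bdd
    have lnn : 0 ≤ sub.lim := ge_of_tendsto' lim fun n => div_nonneg (un n) (Nat.cast_nonneg _)
    refine ⟨-sub.lim, by linarith, ?_⟩
    have lo : Tendsto (fun T : ℝ => -((u ⌈T⌉₊ / ⌈T⌉₊) * (⌈T⌉₊ / T))) atTop (nhds (-(sub.lim * 1))) :=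
      ((lim.comp tendsto_nat_ceil_atTop).mul (tendsto_nat_ceil_div_atTop)).neg
    have hi : Tendsto (fun T : ℝ => -((u ⌊T⌋₊ / ⌊T⌋₊) * (⌊T⌋₊ / T))) atTop (nhds (-(sub.lim * 1))) :=
      ((lim.comp tendsto_nat_floor_atTop).mul (tendsto_nat_floor_div_atTop)).neg
    rw [mul_one] at lo hi
    refine tendsto_of_tendsto_of_tendsto_of_le_of_le' lo hi ?_ ?_
    · filter_upwards [eventually_ge_atTop 1] with T hT
      have c1 : (0 : ℝ) < ⌈T⌉₊ := lt_of_lt_of_le (by linarith) (Nat.le_ceil T)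
      have h := Real.log_le_log (pos _) (hanti (Nat.le_ceil T))
      rw [div_mul_div_cancel₀ c1.ne', one_div_mul_eq_div, ← neg_div]
      exact div_le_div_of_nonneg_right (by simpa [hu] using h) (by linarith)
    · filter_upwards [eventually_ge_atTop 1] with T hT
      have c1 : (0 : ℝ) < ⌊T⌋₊ := by
        have : 0 < ⌊T⌋₊ := Nat.floor_pos.2 hT
        exact_mod_cast this
      have h := Real.log_le_log (pos _) (hanti (Nat.floor_le (by linarith : 0 ≤ T)))
      rw [div_mul_div_cancel₀ c1.ne', one_div_mul_eq_div, ← neg_div]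
      exact div_le_div_of_nonneg_right (by simpa [hu] using h) (by linarith)

/-- **Existence of the persistence exponent.** For a centered stationary Gaussian process
with continuous sample paths, unit variance and nonnegative covariance depending only on
`t - s`, the limit `lim_{T→∞} (1/T) log P(sup_{t ∈ [0,T]} Z_t < 0)` exists in `[-∞, 0]`. -/
theorem persistence_exponent_exists
    (Ω : Type*) [MeasurableSpace Ω] (μ : Measure Ω) [IsProbabilityMeasure μ]
    (Z : ℝ → Ω → ℝ)
    (hG : IsCenteredGaussianProcess μ Z)
    (hcont : ∀ ω, Continuous fun t => Z t ω)
    (hvar : ∀ t, (∫ ω, (Z t ω) ^ 2 ∂μ) = 1)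
    (ρ : ℝ → ℝ)
    (hcov : ∀ s t : ℝ, (∫ ω, Z s ω * Z t ω ∂μ) = ρ (t - s))
    (hnonneg : ∀ τ : ℝ, 0 ≤ ρ τ) :
    ∃ l : EReal, l ≤ 0 ∧
      Tendsto (fun T : ℝ =>
          (((1 / T) * Real.log
            ((μ {ω | ∀ t ∈ Icc (0:ℝ) T, Z t ω < 0}).toReal) : ℝ) : EReal))
        atTop (nhds l) := by
  obtain ⟨l, hl, hlim⟩ := fekete_real (fun T => μ.real {ω | ∀ t ∈ Icc (0:ℝ) T, Z t ω < 0})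
    (fun T => measureReal_le_one) (fun T => measureReal_nonneg)
    (fun S T hST => measureReal_mono fun ω hω t ht => hω t ⟨ht.1, ht.2.trans hST⟩)
    (fun S T hS hT => persist_super hG hcont hcov hnonneg hS hT)
  exact ⟨(l : EReal), by exact_mod_cast hl, (continuous_coe_real_ereal.tendsto l).comp hlim⟩
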